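/- arXiv:0901.3039 — 2 statements merged into one kernel-verified Lean document; each statement's English description precedes it below -/
import Mathlib

section
/- Let H be a subgroup of a finite group G with S the Irr(H) × Irr(H) matrix S_{ψ,ψ'} = ⟨Ind_H^G ψ, Ind_H^G ψ'⟩_G, and let m be a positive integer. If the matrix power S^m is strictly positive (every entry positive), then there exists a positive integer q such that S^{m+1} ≤ q · S^m entrywise; consequently H is a subgroup of depth 2m+1 in G. -/
open scoped BigOperators Classical ComplexOrder

noncomputable def innerProd (K : Type) [Group K] [Fintype K] (φ φ' : K → ℂ) : ℂ :=
  (Fintype.card K : ℂ)⁻¹ * ∑ k : K, φ k * (starRingEnd ℂ) (φ' k)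

noncomputable def ind {G : Type} [Group G] [Fintype G] (H : Subgroup G) (ψ : H → ℂ) :
    G → ℂ :=
  fun g => (Fintype.card H : ℂ)⁻¹ *
    ∑ x : G, if h : x⁻¹ * g * x ∈ H then ψ ⟨x⁻¹ * g * x, h⟩ else 0

def res {G : Type} [Group G] (H : Subgroup G) (φ : G → ℂ) : H → ℂ :=
  fun h => φ (h : G)

def IsIrrChar (K : Type) [Group K] [Fintype K] (ψ : K → ℂ) : Prop :=
  ∃ V : FDRep ℂ K, CategoryTheory.Simple V ∧ ψ = V.character

/-- The operator `T ψ = Res_H (Ind_H^G ψ)` on (class) functions of `H`. -/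
noncomputable def resInd {G : Type} [Group G] [Fintype G] (H : Subgroup G)
    (ψ : H → ℂ) : H → ℂ :=
  res H (ind H ψ)

/-- The matrix `S` of inner products of induced irreducible characters:
`S ψ ψ' = ⟨Ind_H^G ψ, Ind_H^G ψ'⟩_G`. -/
noncomputable def indMat {G : Type} [Group G] [Fintype G] (H : Subgroup G) :
    Matrix {ψ : H → ℂ // IsIrrChar H ψ} {ψ : H → ℂ // IsIrrChar H ψ} ℂ :=
  fun ψ ψ' => innerProd G (ind H ψ.1) (ind H ψ'.1)


/-- For an endomorphism of finite order, the trace of the inverse is the conjugate of the trace. -/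
lemma trace_inv_eq_conj {V : Type} [AddCommGroup V] [Module ℂ V] [FiniteDimensional ℂ V]
    (f g : Module.End ℂ V) (n : ℕ) (hn : 0 < n) (hf : f ^ n = 1) (hgf : g * f = 1) :
    LinearMap.trace ℂ V g = (starRingEnd ℂ) (LinearMap.trace ℂ V f) := by
  have hss : f.IsSemisimple := by
    apply Module.End.isSemisimple_of_squarefree_aeval_eq_zero
      (p := (Polynomial.X ^ n - 1 : Polynomial ℂ))
    · apply Polynomial.Separable.squarefree
      have := Polynomial.separable_X_pow_sub_C (F := ℂ) (n := n) 1
        (by exact_mod_cast hn.ne') one_ne_zero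
      simpa using this
    · simp [hf]
  have htop : ⨆ μ : ℂ, f.eigenspace μ = ⊤ := by
    rw [← Module.End.iSup_maxGenEigenspace_eq_top f]
    congr 1
    ext1 μ
    exact (hss.isFinitelySemisimple.maxGenEigenspace_eq_eigenspace μ).symm
  have hint : DirectSum.IsInternal (fun μ : ℂ => f.eigenspace μ) :=
    (DirectSum.isInternal_submodule_iff_iSupIndep_and_iSup_eq_top _).2
      ⟨f.eigenspaces_iSupIndep, htop⟩
  have hfin : {μ : ℂ | f.eigenspace μ ≠ ⊥}.Finite :=
    WellFoundedGT.finite_ne_bot_of_iSupIndep f.eigenspaces_iSupIndep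
  have hne : ∀ μ : ℂ, f.eigenspace μ ≠ ⊥ → μ ^ n = 1 := by
    intro μ hμ
    obtain ⟨v, hv, hv0⟩ := Submodule.exists_mem_ne_zero_of_ne_bot hμ
    have h1 : (f ^ n) v = μ ^ n • v := by
      have : f.HasEigenvector μ v := ⟨hv, hv0⟩
      exact this.pow_apply n
    rw [hf] at h1
    have h2 : (μ ^ n - 1) • v = 0 := by
      rw [sub_smul, ← h1]; simp
    rcases smul_eq_zero.1 h2 with h | h
    · exact sub_eq_zero.1 h
    · exact absurd h hv0
  have hgv : ∀ (μ : ℂ) (v : V), v ∈ f.eigenspace μ → g v = μ⁻¹ • v := by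
    intro μ v hv
    by_cases hv0 : v = 0
    · simp [hv0]
    have hμ : μ ^ n = 1 := hne μ (fun h => hv0 (by rw [h] at hv; simpa using hv))
    have hμ0 : μ ≠ 0 := by rintro rfl; simp [hn.ne'] at hμ
    have h1 : f v = μ • v := Module.End.mem_eigenspace_iff.1 hv
    have h2 : g (f v) = v := by
      have := LinearMap.congr_fun hgf v
      simpa using this
    rw [h1, map_smul] at h2
    rw [← h2, smul_smul, inv_mul_cancel₀ hμ0, one_smul, h2]
  have hmf : ∀ μ : ℂ, Set.MapsTo f (f.eigenspace μ) (f.eigenspace μ) := by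
    intro μ v hv
    have hv' : v ∈ f.eigenspace μ := hv
    rw [Module.End.mem_eigenspace_iff.1 hv']
    exact Submodule.smul_mem _ _ hv'
  have hmg : ∀ μ : ℂ, Set.MapsTo g (f.eigenspace μ) (f.eigenspace μ) := by
    intro μ v hv
    have hv' : v ∈ f.eigenspace μ := hv
    rw [hgv μ v hv']
    exact Submodule.smul_mem _ _ hv'
  rw [LinearMap.trace_eq_sum_trace_restrict' hint hfin hmf,
    LinearMap.trace_eq_sum_trace_restrict' hint hfin hmg, map_sum]
  refine Finset.sum_congr rfl fun μ hμ => ?_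
  have hμ1 : μ ^ n = 1 := hne μ (by simpa using hμ)
  have e1 : f.restrict (hmf μ) = μ • LinearMap.id := by
    ext v
    exact Module.End.mem_eigenspace_iff.1 v.2
  have e2 : g.restrict (hmg μ) = μ⁻¹ • LinearMap.id := by
    ext v
    exact hgv μ v.1 v.2
  rw [e1, e2, map_smul, map_smul, LinearMap.trace_id]
  have : (starRingEnd ℂ) μ = μ⁻¹ := by
    rw [Complex.inv_eq_conj]
    exact Complex.norm_eq_one_of_pow_eq_one hμ1 hn.ne'
  simp [this]

lemma rep_char_inv {K : Type} [Group K] [Fintype K] {V : Type} [AddCommGroup V] [Module ℂ V]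
    [FiniteDimensional ℂ V] (ρ : Representation ℂ K V) (k : K) :
    LinearMap.trace ℂ V (ρ k⁻¹) = (starRingEnd ℂ) (LinearMap.trace ℂ V (ρ k)) := by
  apply trace_inv_eq_conj _ _ (Fintype.card K) Fintype.card_pos
  · rw [← map_pow, pow_card_eq_one, map_one]
  · rw [← map_mul, inv_mul_cancel, map_one]

lemma irr_inv {K : Type} [Group K] [Fintype K] {ψ : K → ℂ} (h : IsIrrChar K ψ) (k : K) :
    ψ k⁻¹ = (starRingEnd ℂ) (ψ k) := by
  obtain ⟨V, -, rfl⟩ := h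
  exact rep_char_inv V.ρ k

lemma irr_conj {K : Type} [Group K] [Fintype K] {ψ : K → ℂ} (h : IsIrrChar K ψ) (g k : K) :
    ψ (k * g * k⁻¹) = ψ g := by
  obtain ⟨V, -, rfl⟩ := h
  exact V.char_conj g k

lemma irr_orthonormal {K : Type} [Group K] [Fintype K] {ψ ψ' : K → ℂ} (h : IsIrrChar K ψ)
    (h' : IsIrrChar K ψ') : innerProd K ψ ψ' = if ψ = ψ' then 1 else 0 := by
  have hinv := irr_inv h'
  obtain ⟨V, hV, rfl⟩ := h
  obtain ⟨W, hW, rfl⟩ := h'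
  have : Invertible (Nat.card K : ℂ) := invertibleOfNonzero (by
    rw [Nat.card_eq_fintype_card]; exact_mod_cast Fintype.card_ne_zero)
  have key : ∀ W' : FDRep ℂ K, CategoryTheory.Simple W' →
      W'.character = W.character → innerProd K V.character W.character =
      if Nonempty (V ≅ W') then 1 else 0 := by
    intro W' _ hc
    have := FDRep.char_orthonormal V W'
    rw [Nat.card_eq_fintype_card] at this
    rw [← this]
    unfold innerProd
    congr 1
    refine Finset.sum_congr rfl fun k _ => ?_
    rw [← hinv, hc]
  split_ifs with hVW
  · rw [key V hV hVW, if_pos ⟨CategoryTheory.Iso.refl V⟩]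
  · rw [key W hW rfl, if_neg]
    rintro ⟨i⟩
    exact hVW (FDRep.char_iso i)

lemma irr_of_irreducible {K : Type} [Group K] [Fintype K] {V : Type} [AddCommGroup V] [Module ℂ V]
    [FiniteDimensional ℂ V] (ρ : Representation ℂ K V) (h : ρ.IsIrreducible) :
    IsIrrChar K ρ.character := by
  have : Invertible (Nat.card K : ℂ) := invertibleOfNonzero (by
    rw [Nat.card_eq_fintype_card]; exact_mod_cast Fintype.card_ne_zero)
  refine ⟨FDRep.of ρ, ?_, ?_⟩
  · rw [FDRep.simple_iff_char_is_norm_one]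
    have h1 := Representation.char_orthonormal ρ ρ
    rw [if_pos ⟨Representation.Equiv.refl ρ⟩] at h1
    have h2 : (Nat.card K : ℂ) ≠ 0 := Invertible.ne_zero _
    rw [inv_mul_eq_one₀ h2] at h1
    exact h1.symm
  · rfl

open scoped MonoidAlgebra in
/-- A class function orthogonal to all irreducible characters vanishes. -/
lemma class_fun_eq_zero {K : Type} [Group K] [Fintype K] (f : K → ℂ)
    (hf : ∀ g k, f (k * g * k⁻¹) = f g)
    (ho : ∀ ψ, IsIrrChar K ψ → innerProd K f ψ = 0) : f = 0 := by
  have hcard : (Fintype.card K : ℂ) ≠ 0 := by exact_mod_cast Fintype.card_ne_zero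
  have : NeZero (Nat.card K : ℂ) := ⟨by rwa [Nat.card_eq_fintype_card]⟩
  have ho' : ∀ ψ, IsIrrChar K ψ → ∑ k, f k * ψ k⁻¹ = 0 := by
    intro ψ hψ
    have := ho ψ hψ
    unfold innerProd at this
    rcases mul_eq_zero.1 this with h | h
    · exact absurd h (inv_ne_zero hcard)
    · rw [← h]
      exact Finset.sum_congr rfl fun k _ => by rw [irr_inv hψ]
  set a : ℂ[K] := ∑ k, MonoidAlgebra.single k⁻¹ (f k) with ha
  -- `a` acts as zero on irreducible representations
  have hirr : ∀ (V : Type) [AddCommGroup V] [Module ℂ V] [FiniteDimensional ℂ V]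
      (ρ : Representation ℂ K V), ρ.IsIrreducible → ρ.asAlgebraHom a = 0 := by
    intro V _ _ _ ρ hρ
    have hA : ρ.asAlgebraHom a = ∑ k, f k • ρ k⁻¹ := by
      simp [ha, Representation.asAlgebraHom_single]
    have hcomm : ∀ g : K, (ρ.asAlgebraHom a) ∘ₗ ρ g = ρ g ∘ₗ (ρ.asAlgebraHom a) := by
      intro g
      change (ρ.asAlgebraHom a) * ρ g = ρ g * (ρ.asAlgebraHom a)
      rw [hA, Finset.sum_mul, Finset.mul_sum]
      refine Fintype.sum_equiv (MulAut.conj g⁻¹).toEquiv _ _ fun k => ?_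
      have e : (MulAut.conj g⁻¹).toEquiv k = g⁻¹ * k * (g⁻¹)⁻¹ := rfl
      rw [e, hf, smul_mul_assoc, mul_smul_comm, ← map_mul, ← map_mul]
      congr 2
      group
    let F : Representation.IntertwiningMap ρ ρ := ⟨ρ.asAlgebraHom a, hcomm⟩
    obtain ⟨c, hc⟩ := (Representation.IsIrreducible.algebraMap_intertwiningMap_bijective_of_isAlgClosed
      (ρ := ρ)).2 F
    have hc' : ρ.asAlgebraHom a = c • LinearMap.id := by
      have h1 : F.toLinearMap = (algebraMap ℂ (Representation.IntertwiningMap ρ ρ) c).toLinearMap := by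
        rw [hc]
      have h2 : (algebraMap ℂ (Representation.IntertwiningMap ρ ρ) c).toLinearMap
          = c • LinearMap.id := by
        rfl
      exact h1.trans h2
    have htr : LinearMap.trace ℂ V (ρ.asAlgebraHom a) = 0 := by
      rw [hA, map_sum, ← ho' _ (irr_of_irreducible ρ hρ)]
      refine Finset.sum_congr rfl fun k _ => ?_
      rw [map_smul]; rfl
    rw [hc', map_smul, LinearMap.trace_id, smul_eq_mul] at htr
    have hnt : Nontrivial V := by
      by_contra hV
      rw [not_nontrivial_iff_subsingleton] at hV
      have h3 : (⊥ : Subrepresentation ρ) = ⊤ := by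
        ext v
        have : v = 0 := Subsingleton.elim _ _
        subst this
        exact ⟨fun _ => trivial, fun _ => (⊥ : Subrepresentation ρ).toSubmodule.zero_mem⟩
      exact bot_ne_top h3
    rcases mul_eq_zero.1 htr with h | h
    · rw [hc', h, zero_smul]
    · exact absurd h (by exact_mod_cast (Module.finrank_pos (R := ℂ) (M := V)).ne')
  have hact : ∀ (N : Submodule ℂ[K] ℂ[K]) (r : ℂ[K]) (n : N),
      (Representation.ofModule' (k := ℂ) (G := K) N).asAlgebraHom r n = r • n := by
    intro N r n
    simp [Representation.ofModule', Representation.asAlgebraHom]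
  have : FiniteDimensional ℂ ℂ[K] := inferInstance
  have hann : ∀ x : ℂ[K], a * x = 0 := by
    intro x
    have hx : x ∈ sSup {m : Submodule ℂ[K] ℂ[K] | IsSimpleModule ℂ[K] m} := by
      rw [IsSemisimpleModule.sSup_simples_eq_top]; trivial
    rw [sSup_eq_iSup'] at hx
    induction hx using Submodule.iSup_induction' with
    | mem N n hn =>
      have hs : IsSimpleModule ℂ[K] N.1 := N.2
      have hσ : (Representation.ofModule' (k := ℂ) (G := K) N.1).IsIrreducible := by
        rw [Representation.irreducible_iff_isSimpleModule_asModule]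
        have hsm : ∀ (r : ℂ[K]) (x : (Representation.ofModule' (k := ℂ) (G := K) N.1).asModule),
            Representation.asModuleEquiv _ (r • x) = r • (Representation.asModuleEquiv _ x) := by
          intro r x
          rw [Representation.asModuleEquiv_map_smul]
          exact hact N.1 r _
        let e : (Representation.ofModule' (k := ℂ) (G := K) N.1).asModule ≃ₗ[ℂ[K]] N.1 :=
          { (Representation.ofModule' (k := ℂ) (G := K) N.1).asModuleEquiv.toAddEquiv with
            map_smul' := hsm }
        exact IsSimpleModule.congr e
      have : FiniteDimensional ℂ N.1 :=
        FiniteDimensional.of_injective (N.1.subtype.restrictScalars ℂ) N.1.subtype_injective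
      have h0 := hirr _ _ hσ
      have h1 := hact N.1 a ⟨n, hn⟩
      rw [h0] at h1
      exact (congrArg Subtype.val h1).symm
    | zero => simp
    | add x y _ _ hx hy => rw [mul_add, hx, hy, add_zero]
  have ha0 : a = 0 := by simpa using hann 1
  ext k
  have h1 : a.coeff k⁻¹ = f k := by
    simp [ha, Finsupp.single_apply]
  rw [← h1, ha0]; simp

lemma innerProd_conj {K : Type} [Group K] [Fintype K] (φ φ' : K → ℂ) :
    (starRingEnd ℂ) (innerProd K φ φ') = innerProd K φ' φ := by
  unfold innerProd
  rw [map_mul, map_sum, map_inv₀, Complex.conj_natCast]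
  congr 1
  refine Finset.sum_congr rfl fun k _ => ?_
  rw [map_mul, Complex.conj_conj, mul_comm]

lemma innerProd_sum_left {K ι : Type} [Group K] [Fintype K] [Fintype ι] (c : ι → ℂ)
    (φ : ι → K → ℂ) (φ' : K → ℂ) :
    innerProd K (∑ i, c i • φ i) φ' = ∑ i, c i * innerProd K (φ i) φ' := by
  unfold innerProd
  simp only [Finset.sum_apply, Pi.smul_apply, smul_eq_mul, Finset.sum_mul, Finset.mul_sum]
  rw [Finset.sum_comm]
  refine Finset.sum_congr rfl fun i _ => Finset.sum_congr rfl fun k _ => ?_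
  ring

lemma innerProd_sub_left {K : Type} [Group K] [Fintype K] (a b φ' : K → ℂ) :
    innerProd K (a - b) φ' = innerProd K a φ' - innerProd K b φ' := by
  unfold innerProd
  simp only [Pi.sub_apply, sub_mul, Finset.sum_sub_distrib, mul_sub]

lemma ind_class {G : Type} [Group G] [Fintype G] (H : Subgroup G) (ψ : H → ℂ) (g k : G) :
    ind H ψ (k * g * k⁻¹) = ind H ψ g := by
  unfold ind
  congr 1
  refine Fintype.sum_equiv (Equiv.mulLeft k⁻¹) _ _ fun x => ?_
  have e : x⁻¹ * (k * g * k⁻¹) * x = (k⁻¹ * x)⁻¹ * g * (k⁻¹ * x) := by group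
  let ψ₀ : G → ℂ := fun g => if h : g ∈ H then ψ ⟨g, h⟩ else 0
  change ψ₀ (x⁻¹ * (k * g * k⁻¹) * x) = ψ₀ ((k⁻¹ * x)⁻¹ * g * (k⁻¹ * x))
  rw [e]

lemma ind_inv {G : Type} [Group G] [Fintype G] (H : Subgroup G) (ψ : H → ℂ)
    (hψ : ∀ h, ψ h⁻¹ = (starRingEnd ℂ) (ψ h)) (g : G) :
    ind H ψ g⁻¹ = (starRingEnd ℂ) (ind H ψ g) := by
  unfold ind
  rw [map_mul, map_sum, map_inv₀, Complex.conj_natCast]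
  congr 1
  refine Finset.sum_congr rfl fun x _ => ?_
  have e : x⁻¹ * g⁻¹ * x = (x⁻¹ * g * x)⁻¹ := by group
  by_cases h : x⁻¹ * g * x ∈ H
  · have h' : x⁻¹ * g⁻¹ * x ∈ H := by rw [e]; exact H.inv_mem h
    rw [dif_pos h, dif_pos h', ← hψ]
    congr 1
    exact Subtype.ext e
  · have h' : ¬ x⁻¹ * g⁻¹ * x ∈ H := by rw [e]; exact fun h1 => h (H.inv_mem_iff.1 h1)
    rw [dif_neg h, dif_neg h', map_zero]

lemma frobenius_recip {G : Type} [Group G] [Fintype G] (H : Subgroup G) (ψ : H → ℂ) (φ : G → ℂ)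
    (hφ : ∀ g k, φ (k * g * k⁻¹) = φ g) :
    innerProd G (ind H ψ) φ = innerProd H ψ (res H φ) := by
  have hG : (Fintype.card G : ℂ) ≠ 0 := by exact_mod_cast Fintype.card_ne_zero
  let ψ₀ : G → ℂ := fun g => if h : g ∈ H then ψ ⟨g, h⟩ else 0
  have h0 : ∀ g, ind H ψ g = (Fintype.card H : ℂ)⁻¹ * ∑ x : G, ψ₀ (x⁻¹ * g * x) := fun g => rfl
  have h1 : ∀ x : G, ∑ g, ψ₀ (x⁻¹ * g * x) * (starRingEnd ℂ) (φ g)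
      = ∑ g, ψ₀ g * (starRingEnd ℂ) (φ g) := by
    intro x
    refine Fintype.sum_equiv (MulAut.conj x⁻¹).toEquiv _ _ fun g => ?_
    have e : (MulAut.conj x⁻¹).toEquiv g = x⁻¹ * g * (x⁻¹)⁻¹ := rfl
    rw [e, hφ, inv_inv]
  have h2 : ∑ g, ψ₀ g * (starRingEnd ℂ) (φ g) = ∑ h : H, ψ h * (starRingEnd ℂ) (φ h) := by
    have h3 : ∑ h : H, ψ h * (starRingEnd ℂ) (φ h)
        = ∑ h : H, ψ₀ h * (starRingEnd ℂ) (φ h) := by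
      refine Finset.sum_congr rfl fun h _ => ?_
      simp only [ψ₀, dif_pos h.2]
    rw [h3]
    have h4 := Finset.sum_subtype_of_mem (s := Finset.univ.filter (fun g => g ∈ H)) (p := fun g => g ∈ H)
      (fun g => ψ₀ g * (starRingEnd ℂ) (φ g)) (by simp)
    rw [Finset.sum_filter_of_ne] at h4
    · rw [← h4]
      refine Finset.sum_congr ?_ fun _ _ => rfl
      ext; simp
    · intro g _ hg
      by_contra hgH
      simp [ψ₀, hgH] at hg
  unfold innerProd
  simp only [h0]
  have h5 : ∀ g : G, (Fintype.card H : ℂ)⁻¹ * (∑ x : G, ψ₀ (x⁻¹ * g * x)) * (starRingEnd ℂ) (φ g)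
      = (Fintype.card H : ℂ)⁻¹ * ∑ x : G, ψ₀ (x⁻¹ * g * x) * (starRingEnd ℂ) (φ g) := by
    intro g
    rw [mul_assoc, Finset.sum_mul]
  simp only [h5]
  rw [← Finset.mul_sum, Finset.sum_comm]
  simp only [h1, h2, Finset.sum_const, Finset.card_univ, nsmul_eq_mul, res]
  field_simp

lemma indMat_eq {G : Type} [Group G] [Fintype G] (H : Subgroup G)
    (ψ ψ' : {ψ : H → ℂ // IsIrrChar H ψ}) :
    indMat H ψ ψ' = innerProd H (resInd H ψ.1) ψ'.1 := by
  unfold indMat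
  rw [← innerProd_conj, frobenius_recip H _ _ (ind_class H _), innerProd_conj]
  rfl

lemma indMat_real {G : Type} [Group G] [Fintype G] (H : Subgroup G)
    (ψ ψ' : {ψ : H → ℂ // IsIrrChar H ψ}) :
    (starRingEnd ℂ) (indMat H ψ ψ') = indMat H ψ ψ' := by
  unfold indMat innerProd
  rw [map_mul, map_sum, map_inv₀, Complex.conj_natCast]
  congr 1
  refine Fintype.sum_equiv (Equiv.inv G) _ _ fun g => ?_
  rw [Equiv.inv_apply, ind_inv H _ (irr_inv ψ.2), ind_inv H _ (irr_inv ψ'.2), map_mul]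

lemma resInd_sum {G ι : Type} [Group G] [Fintype G] [Fintype ι] (H : Subgroup G)
    (c : ι → ℂ) (φ : ι → H → ℂ) :
    resInd H (∑ i, c i • φ i) = ∑ i, c i • resInd H (φ i) := by
  ext h
  simp only [resInd, res, ind, Finset.sum_apply, Pi.smul_apply, smul_eq_mul, Finset.mul_sum]
  rw [Finset.sum_comm]
  refine Finset.sum_congr rfl fun x _ => ?_
  split_ifs
  · rw [Finset.mul_sum]
    refine Finset.sum_congr rfl fun i _ => ?_
    ring
  · simp

lemma resInd_iter_sum {G ι : Type} [Group G] [Fintype G] [Fintype ι] (H : Subgroup G) (n : ℕ) :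
    ∀ (c : ι → ℂ) (φ : ι → H → ℂ),
    (resInd H)^[n] (∑ i, c i • φ i) = ∑ i, c i • (resInd H)^[n] (φ i) := by
  induction n with
  | zero => intro c φ; rfl
  | succ n ih =>
    intro c φ
    simp only [Function.iterate_succ_apply, resInd_sum, ih]

lemma resInd_expand {G : Type} [Group G] [Fintype G] (H : Subgroup G)
    [Fintype {ψ : H → ℂ // IsIrrChar H ψ}] (ψ : {ψ : H → ℂ // IsIrrChar H ψ}) :
    resInd H ψ.1 = ∑ χ : {ψ : H → ℂ // IsIrrChar H ψ}, indMat H ψ χ • χ.1 := by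
  rw [← sub_eq_zero]
  apply class_fun_eq_zero
  · intro g k
    have h1 : resInd H ψ.1 (k * g * k⁻¹) = resInd H ψ.1 g := by
      have := ind_class H ψ.1 g k
      simpa [resInd, res] using this
    simp only [Pi.sub_apply, Finset.sum_apply, Pi.smul_apply, h1]
    congr 1
    refine Finset.sum_congr rfl fun χ _ => ?_
    rw [irr_conj χ.2]
  · intro θ hθ
    rw [innerProd_sub_left, innerProd_sum_left, ← indMat_eq H ψ ⟨θ, hθ⟩,
      Finset.sum_eq_single ⟨θ, hθ⟩]
    · rw [irr_orthonormal hθ hθ]; simp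
    · intro χ _ hχ
      rw [irr_orthonormal χ.2 hθ, if_neg, mul_zero]
      exact fun h => hχ (Subtype.ext h)
    · simp

lemma innerProd_iter {G : Type} [Group G] [Fintype G] (H : Subgroup G)
    [Fintype {ψ : H → ℂ // IsIrrChar H ψ}] (n : ℕ) :
    ∀ ψ ψ' : {ψ : H → ℂ // IsIrrChar H ψ},
    innerProd H ((resInd H)^[n] ψ.1) ψ'.1 = (indMat H ^ n) ψ ψ' := by
  induction n with
  | zero =>
    intro ψ ψ'
    simp only [Function.iterate_zero, id, pow_zero]
    rw [irr_orthonormal ψ.2 ψ'.2, Matrix.one_apply]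
    simp only [Subtype.ext_iff]
  | succ n ih =>
    intro ψ ψ'
    rw [Function.iterate_succ_apply, resInd_expand, resInd_iter_sum, innerProd_sum_left, pow_succ',
      Matrix.mul_apply]
    simp only [ih]

lemma indMat_pow_real {G : Type} [Group G] [Fintype G] (H : Subgroup G)
    [Fintype {ψ : H → ℂ // IsIrrChar H ψ}] (n : ℕ) :
    ∀ ψ ψ' : {ψ : H → ℂ // IsIrrChar H ψ},
    (starRingEnd ℂ) ((indMat H ^ n) ψ ψ') = (indMat H ^ n) ψ ψ' := by
  induction n with
  | zero => intro ψ ψ'; rw [pow_zero, Matrix.one_apply]; split_ifs <;> simp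
  | succ n ih =>
    intro ψ ψ'
    rw [pow_succ', Matrix.mul_apply, map_sum]
    simp only [map_mul, ih, indMat_real]

/-- If `S^m` is strictly positive then `S^(m+1) ≤ q S^m` entrywise for some positive
integer `q`; consequently `H` is a subgroup of depth `2m+1` in `G`, i.e.
`⟨T^(m+1) ψ, ψ'⟩_H ≤ q ⟨T^m ψ, ψ'⟩_H` for all `ψ, ψ' ∈ Irr(H)`. -/
theorem depth_odd_of_power_strictly_positive {G : Type} [Group G] [Fintype G]
    (H : Subgroup G) [Fintype {ψ : H → ℂ // IsIrrChar H ψ}]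
    (m : ℕ) (hm : 0 < m)
    (hpos : ∀ ψ ψ' : {ψ : H → ℂ // IsIrrChar H ψ}, 0 < (indMat H ^ m) ψ ψ') :
    ∃ q : ℕ, 0 < q ∧
      (∀ ψ ψ' : {ψ : H → ℂ // IsIrrChar H ψ},
        (indMat H ^ (m + 1)) ψ ψ' ≤ (q : ℂ) * (indMat H ^ m) ψ ψ') ∧
      (∀ ψ ψ' : {ψ : H → ℂ // IsIrrChar H ψ},
        innerProd H ((resInd H)^[m + 1] ψ.1) ψ'.1
          ≤ (q : ℂ) * innerProd H ((resInd H)^[m] ψ.1) ψ'.1) := by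
  have key : ∀ p : {ψ : H → ℂ // IsIrrChar H ψ} × {ψ : H → ℂ // IsIrrChar H ψ}, ∃ q : ℕ,
      ((indMat H ^ (m + 1)) p.1 p.2).re ≤ (q : ℝ) * ((indMat H ^ m) p.1 p.2).re := by
    intro p
    have hp : 0 < ((indMat H ^ m) p.1 p.2).re := (Complex.lt_def.1 (hpos p.1 p.2)).1
    obtain ⟨q, hq⟩ := exists_nat_ge
      (((indMat H ^ (m + 1)) p.1 p.2).re / ((indMat H ^ m) p.1 p.2).re)
    exact ⟨q, (div_le_iff₀ hp).1 hq⟩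
  choose q hq using key
  have main : ∀ ψ ψ' : {ψ : H → ℂ // IsIrrChar H ψ},
      (indMat H ^ (m + 1)) ψ ψ' ≤ ((∑ p, q p + 1 : ℕ) : ℂ) * (indMat H ^ m) ψ ψ' := by
    intro ψ ψ'
    have hp : 0 < ((indMat H ^ m) ψ ψ').re := (Complex.lt_def.1 (hpos ψ ψ')).1
    have h1 : (q (ψ, ψ') : ℝ) ≤ ((∑ p, q p + 1 : ℕ) : ℝ) := by
      have : q (ψ, ψ') ≤ ∑ p, q p :=
        Finset.single_le_sum (f := q) (fun _ _ => Nat.zero_le _) (Finset.mem_univ _)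
      exact_mod_cast this.trans (Nat.le_succ _)
    have h2 := Complex.conj_eq_iff_im.1 (indMat_pow_real H (m + 1) ψ ψ')
    have h3 := Complex.conj_eq_iff_im.1 (indMat_pow_real H m ψ ψ')
    rw [Complex.le_def]
    constructor
    · rw [Complex.mul_re, Complex.natCast_re, Complex.natCast_im, zero_mul, sub_zero]
      exact (hq (ψ, ψ')).trans (mul_le_mul_of_nonneg_right h1 hp.le)
    · rw [Complex.mul_im, Complex.natCast_re, Complex.natCast_im, zero_mul, h2, h3, mul_zero,
        add_zero]
  refine ⟨∑ p, q p + 1, Nat.succ_pos _, main, fun ψ ψ' => ?_⟩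
  rw [innerProd_iter, innerProd_iter]
  exact main ψ ψ'
end

section
/- Let G be a Frobenius group with Frobenius complement H, i.e., H is a proper nontrivial subgroup of G such that x H x⁻¹ ∩ H = {1} for every x ∈ G ∖ H. Then ⟨Res_H(Ind_H^G ψ), χ⟩_H > 0 for all irreducible characters ψ, χ of H, and consequently H is a depth three subgroup of G: there exists a positive integer n such that ⟨Res_H(Ind_H^G(Res_H(Ind_H^G ψ))), χ⟩_H ≤ n · ⟨Res_H(Ind_H^G ψ), χ⟩_H for all ψ, χ ∈ Irr(H). -/
open scoped BigOperators Classical ComplexOrder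

lemma char_inv_aux {K : Type} [Group K] [Fintype K] (V : FDRep ℂ K) (g : K) :
    V.character g⁻¹ = (starRingEnd ℂ) (V.character g) := by
  let b := Module.finBasis ℂ V
  let A : K → Matrix _ _ ℂ := fun k => LinearMap.toMatrix b b (V.ρ k)
  have hmul : ∀ x y, A (x * y) = A x * A y := by
    intro x y
    simp only [A, map_mul]
    exact LinearMap.toMatrix_mul b _ _
  have hone : A 1 = 1 := by
    simp only [A, map_one]
    exact LinearMap.toMatrix_one b
  have htr : ∀ x, V.character x = (A x).trace := fun x =>
    LinearMap.trace_eq_matrix_trace ℂ b _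
  let P := ∑ k, (A k).conjTranspose * A k
  have hP : P.PosDef := by
    apply Matrix.posDef_sum (Finset.univ_nonempty)
    intro k _
    apply Matrix.PosDef.conjTranspose_mul_self
    apply Matrix.mulVec_injective_of_isUnit
    exact ⟨⟨A k, A k⁻¹, by rw [← hmul, mul_inv_cancel, hone],
      by rw [← hmul, inv_mul_cancel, hone]⟩, rfl⟩
  have hinv : (A g).conjTranspose * P = P * A g⁻¹ := by
    have h1 : (A g).conjTranspose * P * A g = P := by
      simp only [P, Finset.mul_sum, Finset.sum_mul]
      rw [← Equiv.sum_comp (Equiv.mulRight g) (fun k => (A k).conjTranspose * A k)]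
      refine Finset.sum_congr rfl fun k _ => ?_
      simp only [Equiv.coe_mulRight, hmul, Matrix.conjTranspose_mul, Matrix.mul_assoc]
    calc _ = (A g).conjTranspose * P * A g * A g⁻¹ := by
            rw [Matrix.mul_assoc _ (A g), ← hmul, mul_inv_cancel, hone, Matrix.mul_one]
      _ = _ := by rw [h1]
  have hu : IsUnit P.det := (Matrix.isUnit_iff_isUnit_det _).1 hP.isUnit
  rw [htr, htr]
  calc (A g⁻¹).trace = (P⁻¹ * (P * A g⁻¹)).trace := by
        rw [← Matrix.mul_assoc, Matrix.nonsing_inv_mul _ hu, Matrix.one_mul]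
    _ = ((A g).conjTranspose).trace := by
        rw [← hinv, Matrix.trace_mul_comm, Matrix.mul_assoc, Matrix.mul_nonsing_inv _ hu,
          Matrix.mul_one]
    _ = _ := by rw [Matrix.trace_conjTranspose]; rfl

lemma inner_char_aux {K : Type} [Group K] [Fintype K] {ψ χ : K → ℂ}
    (hψ : IsIrrChar K ψ) (hχ : IsIrrChar K χ) : 0 ≤ innerProd K ψ χ := by
  obtain ⟨V, hV, rfl⟩ := hψ
  obtain ⟨W, hW, rfl⟩ := hχ
  have : Invertible (Nat.card K : ℂ) := invertibleOfNonzero (by simp [Nat.card_eq_fintype_card])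
  have h := FDRep.scalar_product_char_eq_finrank_equivariant W V
  simp only [char_inv_aux, Nat.card_eq_fintype_card] at h
  rw [innerProd, h]
  exact Nat.cast_nonneg _

lemma char_one_aux {K : Type} [Group K] [Fintype K] {ψ : K → ℂ}
    (hψ : IsIrrChar K ψ) : 0 < ψ 1 := by
  obtain ⟨V, hV, rfl⟩ := hψ
  have : Invertible (Nat.card K : ℂ) := invertibleOfNonzero (by simp [Nat.card_eq_fintype_card])
  have h := FDRep.char_orthonormal V V
  rw [FDRep.char_one]
  rcases Nat.eq_zero_or_pos (Module.finrank ℂ V) with h0 | h0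
  · exfalso
    have hs : Subsingleton V := Module.finrank_zero_iff.1 h0
    have hz : ∀ g, V.character g = 0 := by
      intro g
      have : V.ρ g = 0 := by ext x; exact Subsingleton.elim _ _
      rw [FDRep.character, this, map_zero]
    rw [if_pos ⟨CategoryTheory.Iso.refl V⟩] at h
    simp [hz] at h
  · exact_mod_cast h0

lemma class_aux {K : Type} [Group K] [Fintype K] {ψ : K → ℂ}
    (hψ : IsIrrChar K ψ) (x h : K) : ψ (x⁻¹ * h * x) = ψ h := by
  obtain ⟨V, hV, rfl⟩ := hψ
  simpa using V.char_conj h x⁻¹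

lemma resind_aux {G : Type} [Group G] [Fintype G]
    (H : Subgroup G)
    (hmal : ∀ x : G, x ∉ H → ∀ h : G, h ∈ H → x * h * x⁻¹ ∈ H → h = 1)
    (φ : H → ℂ) (hφ : ∀ x h : H, φ (x⁻¹ * h * x) = φ h) :
    res H (ind H φ) = fun h => φ h + if h = 1 then
      (((Fintype.card H : ℂ)⁻¹ * Fintype.card G - 1) * φ 1) else 0 := by
  have hc : (Fintype.card H : ℂ) ≠ 0 := by simp
  funext h
  by_cases h1 : h = 1
  · subst h1
    have : ∀ x : G, (if h : x⁻¹ * ((1 : H) : G) * x ∈ H then φ ⟨x⁻¹ * ((1 : H) : G) * x, h⟩ else 0)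
        = φ 1 := by
      intro x
      have e : x⁻¹ * ((1 : H) : G) * x = 1 := by simp
      rw [dif_pos (by rw [e]; exact H.one_mem)]
      congr 1
      exact Subtype.ext e
    simp only [res, ind, this, if_true, Finset.sum_const, Finset.card_univ, nsmul_eq_mul]
    ring
  · have : ∀ x : G, (if h' : x⁻¹ * (h : G) * x ∈ H then φ ⟨x⁻¹ * (h : G) * x, h'⟩ else 0)
        = if x ∈ H then φ h else 0 := by
      intro x
      by_cases hx : x ∈ H
      · rw [if_pos hx, dif_pos (H.mul_mem (H.mul_mem (H.inv_mem hx) h.2) hx)]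
        exact hφ ⟨x, hx⟩ h
      · rw [if_neg hx, dif_neg]
        intro hm
        apply h1
        apply Subtype.ext
        exact hmal x⁻¹ (by simpa using hx) h h.2 (by simpa using hm)
    simp only [res, ind, this, h1, if_false, add_zero]
    rw [← Finset.sum_filter, Finset.sum_const, nsmul_eq_mul, ← Fintype.card_subtype]
    exact inv_mul_cancel_left₀ hc _

lemma inner_add_aux {K : Type} [Group K] [Fintype K] [DecidableEq K] (ψ χ : K → ℂ) (a : ℂ) :
    innerProd K (fun h => ψ h + if h = 1 then a else 0) χ
      = innerProd K ψ χ + (Fintype.card K : ℂ)⁻¹ * (a * (starRingEnd ℂ) (χ 1)) := by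
  simp [innerProd, add_mul, Finset.sum_add_distrib, mul_add, ite_mul]

theorem frobeniusComplement_depth_three {G : Type} [Group G] [Fintype G]
    (H : Subgroup G) (hbot : H ≠ ⊥) (htop : H ≠ ⊤)
    (hmal : ∀ x : G, x ∉ H → ∀ h : G, h ∈ H → x * h * x⁻¹ ∈ H → h = 1) :
    (∀ ψ χ : H → ℂ, IsIrrChar H ψ → IsIrrChar H χ →
      0 < innerProd H (res H (ind H ψ)) χ) ∧
    ∃ n : ℕ, 0 < n ∧ ∀ ψ χ : H → ℂ, IsIrrChar H ψ → IsIrrChar H χ →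
      innerProd H (res H (ind H (res H (ind H ψ)))) χ
        ≤ (n : ℂ) * innerProd H (res H (ind H ψ)) χ := by
  have hidx : (Fintype.card H : ℂ)⁻¹ * Fintype.card G - 1 = ((H.index - 1 : ℕ) : ℂ) := by
    have h := H.card_mul_index
    rw [Nat.card_eq_fintype_card, Nat.card_eq_fintype_card] at h
    have h0 : H.index ≠ 0 := Subgroup.index_ne_zero_of_finite
    rw [← h, Nat.cast_mul, inv_mul_cancel_left₀ (by simp), Nat.cast_sub (by omega), Nat.cast_one]
  have hpos : 0 < H.index - 1 := by
    have h0 : H.index ≠ 0 := Subgroup.index_ne_zero_of_finite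
    have h1 : H.index ≠ 1 := fun h => htop (Subgroup.index_eq_one.1 h)
    omega
  generalize H.index - 1 = c at hidx hpos
  have key : ∀ φ : H → ℂ, (∀ x h : H, φ (x⁻¹ * h * x) = φ h) →
      res H (ind H φ) = fun h => φ h + if h = 1 then ((c : ℂ) * φ 1) else 0 := by
    intro φ hφ
    rw [resind_aux H hmal φ hφ, hidx]
  have hD : ∀ ψ χ : H → ℂ, IsIrrChar H ψ → IsIrrChar H χ →
      0 < (Fintype.card H : ℂ)⁻¹ * ((c * ψ 1) * (starRingEnd ℂ) (χ 1)) := by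
    intro ψ χ hψ hχ
    have h1 := char_one_aux hψ
    have h2 := char_one_aux hχ
    have h3 : (starRingEnd ℂ) (χ 1) = χ 1 := Complex.conj_eq_iff_im.2 (Complex.pos_iff.1 h2).2.symm
    rw [h3]
    have h4 : (0 : ℂ) < c := by exact_mod_cast hpos
    have h5 : (0 : ℂ) < (Fintype.card H : ℂ)⁻¹ := by
      have : (0 : ℝ) < (Fintype.card H : ℝ)⁻¹ := by
        have : 0 < Fintype.card H := Fintype.card_pos
        positivity
      rw [Complex.pos_iff]
      have e : ((Fintype.card H : ℂ))⁻¹ = (((Fintype.card H : ℝ)⁻¹ : ℝ) : ℂ) := by push_cast; rfl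
      rw [e]
      exact ⟨by simpa only [Complex.ofReal_re] using this, by rw [Complex.ofReal_im]⟩
    exact mul_pos h5 (mul_pos (mul_pos h4 h1) h2)
  refine ⟨?_, c + 2, by omega, ?_⟩
  · intro ψ χ hψ hχ
    rw [key ψ (class_aux hψ), inner_add_aux]
    exact add_pos_of_nonneg_of_pos (inner_char_aux hψ hχ) (hD ψ χ hψ hχ)
  · intro ψ χ hψ hχ
    rw [key ψ (class_aux hψ), key]
    · rw [inner_add_aux, inner_add_aux, ← sub_nonneg]
      have hA := inner_char_aux hψ hχ
      have : (0 : ℂ) ≤ ((c + 1 : ℕ) : ℂ) * innerProd H ψ χ := mul_nonneg (Nat.cast_nonneg _) hA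
      convert this using 1
      push_cast
      simp only [if_true]
      ring
    · intro x h
      have : x⁻¹ * h * x = 1 ↔ h = 1 := by
        constructor
        · intro e
          have : h = x * (x⁻¹ * h * x) * x⁻¹ := by group
          rw [this, e]; simp
        · rintro rfl; simp
      simp only [class_aux hψ, this]
end
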